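/- arXiv:1906.02030 — 5 statements merged into one kernel-verified Lean document; each statement's English description precedes it below -/
import Mathlib

section
/- Under Assumption 1, if 0 < P(Z=1) < 1 and P(U=c) > 0, then RD_{D|Z} = P(U=c) ≠ 0 and the complier average causal effect is identified by the Wald ratio: E(Y_1 − Y_0 | U = c) = RD_{Y|Z} / RD_{D|Z}. -/
open MeasureTheory ProbabilityTheory

noncomputable def pr {Ω : Type*} [MeasurableSpace Ω] (μ : MeasureTheory.Measure Ω)
    (A : Set Ω) : ℝ := (μ A).toReal

noncomputable def cpr {Ω : Type*} [MeasurableSpace Ω] (μ : MeasureTheory.Measure Ω)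
    (B A : Set Ω) : ℝ := (ProbabilityTheory.cond μ B A).toReal

def bin01 : Set ℝ := {0, 1}

theorem pr_inter_eq_pr_mul_cpr {Ω : Type*} [MeasurableSpace Ω] (μ : Measure Ω)
    [IsFiniteMeasure μ] {B : Set Ω} (hB : MeasurableSet B) (A : Set Ω) :
    pr μ (B ∩ A) = pr μ B * cpr μ B A := by
  rw [pr, pr, cpr, ← ENNReal.toReal_mul, mul_comm, cond_mul_eq_inter hB]

theorem cpr_eq_pr_of_measure_inter_eq_mul {Ω : Type*} [MeasurableSpace Ω] {μ : Measure Ω}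
    [IsFiniteMeasure μ] {B A A' : Set Ω} (hB : MeasurableSet B) (hB0 : pr μ B ≠ 0)
    (h_indep : μ (B ∩ A) = μ B * μ A) (h_inter : B ∩ A' = B ∩ A) :
    cpr μ B A' = pr μ A := by
  have h := pr_inter_eq_pr_mul_cpr μ hB A'
  rw [h_inter, pr, h_indep, ENNReal.toReal_mul] at h
  exact (mul_left_cancel₀ hB0 h).symm

theorem pr_eq_pr_inter_add_pr_inter {Ω : Type*} [MeasurableSpace Ω] (μ : Measure Ω)
    [IsFiniteMeasure μ] {X : Ω → ℝ} (hX : Measurable X) (h_bin : ∀ ω, X ω = 0 ∨ X ω = 1)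
    (A : Set Ω) :
    pr μ A = pr μ ({ω | X ω = 1} ∩ A) + pr μ ({ω | X ω = 0} ∩ A) := by
  have h := measureReal_inter_add_sdiff (μ := μ) (s := A) (hX (measurableSet_singleton (1 : ℝ)))
  have h_diff : A \ X ⁻¹' {1} = {ω | X ω = 0} ∩ A := by
    ext ω
    rcases h_bin ω with h | h <;> simp [h]
  rw [h_diff, Set.inter_comm A] at h
  exact h.symm

theorem integrable_of_forall_eq_zero_or_one {Ω : Type*} [MeasurableSpace Ω] (ν : Measure Ω)
    [IsFiniteMeasure ν] {X : Ω → ℝ} (hX : Measurable X) (h_bin : ∀ ω, X ω = 0 ∨ X ω = 1) :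
    Integrable X ν := by
  refine Integrable.of_bound hX.aestronglyMeasurable 1 (ae_of_all _ fun ω => ?_)
  rcases h_bin ω with h | h <;> simp [h]

theorem integral_eq_pr_of_forall_eq_zero_or_one {Ω : Type*} [MeasurableSpace Ω]
    (ν : Measure Ω) {X : Ω → ℝ} (hX : Measurable X) (h_bin : ∀ ω, X ω = 0 ∨ X ω = 1) :
    ∫ ω, X ω ∂ν = pr ν {ω | X ω = 1} := by
  have h : X = {ω | X ω = 1}.indicator 1 := by
    ext ω
    rcases h_bin ω with h | h <;> simp [h]
  conv_lhs => rw [h]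
  exact integral_indicator_one (hX (measurableSet_singleton (1 : ℝ)))

/-- Law of total probability over the principal strata, in the absence of defiers. -/
theorem pr_eq_sum_strata {Ω : Type*} [MeasurableSpace Ω] (μ : Measure Ω)
    [IsFiniteMeasure μ] {D1 D0 : Ω → ℝ} (hD1 : Measurable D1) (hD0 : Measurable D0)
    (h_bin_D1 : ∀ ω, D1 ω = 0 ∨ D1 ω = 1) (h_bin_D0 : ∀ ω, D0 ω = 0 ∨ D0 ω = 1)
    (h_mono : ∀ᵐ ω ∂μ, D0 ω ≤ D1 ω) (A : Set Ω) :
    pr μ A = pr μ ({ω | D1 ω = 1 ∧ D0 ω = 1} ∩ A) + pr μ ({ω | D1 ω = 1 ∧ D0 ω = 0} ∩ A)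
      + pr μ ({ω | D1 ω = 0 ∧ D0 ω = 0} ∩ A) := by
  have h_def : pr μ ({ω | D1 ω = 0} ∩ ({ω | D0 ω = 1} ∩ A)) = 0 := by
    have h : μ ({ω | D1 ω = 0} ∩ ({ω | D0 ω = 1} ∩ A)) = 0 := by
      refine measure_mono_null ?_ (ae_iff.mp h_mono)
      rintro ω ⟨h1, h0, -⟩
      simp only [Set.mem_ofPred_eq] at h1 h0 ⊢
      norm_num [h1, h0]
    simp [pr, h]
  have h := pr_eq_pr_inter_add_pr_inter μ hD0 h_bin_D0 A
  rw [pr_eq_pr_inter_add_pr_inter μ hD1 h_bin_D1 ({ω | D0 ω = 1} ∩ A),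
    pr_eq_pr_inter_add_pr_inter μ hD1 h_bin_D1 ({ω | D0 ω = 0} ∩ A), h_def, add_zero,
    ← add_assoc] at h
  simpa only [← Set.inter_assoc, ← Set.ofPred_and] using h

/-- Under randomization, the risk difference of an outcome given the assignment equals the
difference of the marginal probabilities of its potential values. -/
theorem riskDifference_eq_sub {Ω : Type*} [MeasurableSpace Ω] {μ : Measure Ω}
    [IsFiniteMeasure μ] {Z R R1 R0 : Ω → ℝ} (hZ : Measurable Z)
    (h_cons : ∀ ω, R ω = Z ω * R1 ω + (1 - Z ω) * R0 ω)
    (h_indep1 : IndepFun Z R1 μ) (h_indep0 : IndepFun Z R0 μ)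
    (h1 : pr μ {ω | Z ω = 1} ≠ 0) (h0 : pr μ {ω | Z ω = 0} ≠ 0) :
    cpr μ {ω | Z ω = 1} {ω | R ω = 1} - cpr μ {ω | Z ω = 0} {ω | R ω = 1}
      = pr μ {ω | R1 ω = 1} - pr μ {ω | R0 ω = 1} := by
  congr 1
  · refine cpr_eq_pr_of_measure_inter_eq_mul (hZ (measurableSet_singleton (1 : ℝ))) h1
      (h_indep1.measure_inter_preimage_eq_mul {1} {1} (measurableSet_singleton _)
        (measurableSet_singleton _)) ?_
    ext ω
    simp +contextual [h_cons]
  · refine cpr_eq_pr_of_measure_inter_eq_mul (hZ (measurableSet_singleton (0 : ℝ))) h0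
      (h_indep0.measure_inter_preimage_eq_mul {0} {1} (measurableSet_singleton _)
        (measurableSet_singleton _)) ?_
    ext ω
    simp +contextual [h_cons]

set_option maxHeartbeats 1000000 in
theorem stmt0 {Ω : Type*} [MeasurableSpace Ω]
    (μ : MeasureTheory.Measure Ω) [IsProbabilityMeasure μ]
    (Z D Y D1 D0 Y1 Y0 : Ω → ℝ)
    (h_meas_Z : Measurable Z)
    (h_meas_D : Measurable D)
    (h_meas_Y : Measurable Y)
    (h_meas_D1 : Measurable D1)
    (h_meas_D0 : Measurable D0)
    (h_meas_Y1 : Measurable Y1)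
    (h_meas_Y0 : Measurable Y0)
    (h_bin_Z : ∀ ω, Z ω = 0 ∨ Z ω = 1)
    (h_bin_D1 : ∀ ω, D1 ω = 0 ∨ D1 ω = 1)
    (h_bin_D0 : ∀ ω, D0 ω = 0 ∨ D0 ω = 1)
    (h_bin_Y1 : ∀ ω, Y1 ω = 0 ∨ Y1 ω = 1)
    (h_bin_Y0 : ∀ ω, Y0 ω = 0 ∨ Y0 ω = 1)
    (h_consD : ∀ ω, D ω = Z ω * D1 ω + (1 - Z ω) * D0 ω)
    (h_consY : ∀ ω, Y ω = Z ω * Y1 ω + (1 - Z ω) * Y0 ω)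
    (h_indep : IndepFun Z (fun ω => (Y1 ω, Y0 ω, D1 ω, D0 ω)) μ)
    (h_mono : ∀ᵐ ω ∂μ, D0 ω ≤ D1 ω)
    (h_exclA : cpr μ {ω | D1 ω = 1 ∧ D0 ω = 1} {ω | Y1 ω = 1}
        = cpr μ {ω | D1 ω = 1 ∧ D0 ω = 1} {ω | Y0 ω = 1})
    (h_exclN : cpr μ {ω | D1 ω = 0 ∧ D0 ω = 0} {ω | Y1 ω = 1}
        = cpr μ {ω | D1 ω = 0 ∧ D0 ω = 0} {ω | Y0 ω = 1})
    (h_Zpos : 0 < pr μ {ω | Z ω = 1}) (h_Zlt : pr μ {ω | Z ω = 1} < 1)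
    (h_Uc : 0 < pr μ {ω | D1 ω = 1 ∧ D0 ω = 0}) :
    ((cpr μ {ω | Z ω = 1} {ω | D ω = 1} - cpr μ {ω | Z ω = 0} {ω | D ω = 1}) = pr μ {ω | D1 ω = 1 ∧ D0 ω = 0})
    ∧ ((cpr μ {ω | Z ω = 1} {ω | D ω = 1} - cpr μ {ω | Z ω = 0} {ω | D ω = 1}) ≠ 0)
    ∧ (∫ ω, (Y1 ω - Y0 ω) ∂(ProbabilityTheory.cond μ {ω | D1 ω = 1 ∧ D0 ω = 0})
        = (cpr μ {ω | Z ω = 1} {ω | Y ω = 1} - cpr μ {ω | Z ω = 0} {ω | Y ω = 1}) / (cpr μ {ω | Z ω = 1} {ω | D ω = 1} - cpr μ {ω | Z ω = 0} {ω | D ω = 1})) := by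
  have h_Z0 : pr μ {ω | Z ω = 0} ≠ 0 := by
    have h := pr_eq_pr_inter_add_pr_inter μ h_meas_Z h_bin_Z Set.univ
    rw [Set.inter_univ, Set.inter_univ] at h
    have h_univ : pr μ Set.univ = 1 := by simp [pr]
    linarith
  have h_strata := pr_eq_sum_strata μ h_meas_D1 h_meas_D0 h_bin_D1 h_bin_D0 h_mono
  have hRD_D := riskDifference_eq_sub h_meas_Z h_consD
    (h_indep.comp measurable_id (by fun_prop : Measurable fun p : ℝ × ℝ × ℝ × ℝ => p.2.2.1))
    (h_indep.comp measurable_id (by fun_prop : Measurable fun p : ℝ × ℝ × ℝ × ℝ => p.2.2.2))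
    h_Zpos.ne' h_Z0
  have hRD_Y := riskDifference_eq_sub h_meas_Z h_consY
    (h_indep.comp measurable_id (by fun_prop : Measurable fun p : ℝ × ℝ × ℝ × ℝ => p.1))
    (h_indep.comp measurable_id (by fun_prop : Measurable fun p : ℝ × ℝ × ℝ × ℝ => p.2.1))
    h_Zpos.ne' h_Z0
  have hD : pr μ {ω | D1 ω = 1} - pr μ {ω | D0 ω = 1} = pr μ {ω | D1 ω = 1 ∧ D0 ω = 0} := by
    have h_a1 : {ω | D1 ω = 1 ∧ D0 ω = 1} ∩ {ω | D1 ω = 1} = {ω | D1 ω = 1 ∧ D0 ω = 1} := by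
      ext ω; simp +contextual
    have h_a0 : {ω | D1 ω = 1 ∧ D0 ω = 1} ∩ {ω | D0 ω = 1} = {ω | D1 ω = 1 ∧ D0 ω = 1} := by
      ext ω; simp +contextual
    have h_c1 : {ω | D1 ω = 1 ∧ D0 ω = 0} ∩ {ω | D1 ω = 1} = {ω | D1 ω = 1 ∧ D0 ω = 0} := by
      ext ω; simp +contextual
    have h_c0 : {ω | D1 ω = 1 ∧ D0 ω = 0} ∩ {ω | D0 ω = 1} = ∅ := by
      ext ω; simp +contextual
    have h_n1 : {ω | D1 ω = 0 ∧ D0 ω = 0} ∩ {ω | D1 ω = 1} = ∅ := by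
      ext ω; simp +contextual
    have h_n0 : {ω | D1 ω = 0 ∧ D0 ω = 0} ∩ {ω | D0 ω = 1} = ∅ := by
      ext ω; simp +contextual
    have h_empty : pr μ ∅ = 0 := by simp [pr]
    rw [h_strata {ω | D1 ω = 1}, h_strata {ω | D0 ω = 1}, h_a1, h_a0, h_c1, h_c0, h_n1, h_n0,
      h_empty]
    ring
  have h_meas_U (i j : ℝ) : MeasurableSet {ω | D1 ω = i ∧ D0 ω = j} :=
    (h_meas_D1 (measurableSet_singleton i)).inter (h_meas_D0 (measurableSet_singleton j))
  have hY : pr μ {ω | Y1 ω = 1} - pr μ {ω | Y0 ω = 1}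
      = pr μ {ω | D1 ω = 1 ∧ D0 ω = 0} * (cpr μ {ω | D1 ω = 1 ∧ D0 ω = 0} {ω | Y1 ω = 1}
        - cpr μ {ω | D1 ω = 1 ∧ D0 ω = 0} {ω | Y0 ω = 1}) := by
    rw [h_strata {ω | Y1 ω = 1}, h_strata {ω | Y0 ω = 1}]
    simp only [pr_inter_eq_pr_mul_cpr μ (h_meas_U _ _)]
    rw [h_exclA, h_exclN]
    ring
  refine ⟨hRD_D.trans hD, (hRD_D.trans hD).trans_ne h_Uc.ne', ?_⟩
  rw [hRD_D, hD, hRD_Y, hY, mul_div_cancel_left₀ _ h_Uc.ne',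
    integral_sub (integrable_of_forall_eq_zero_or_one _ h_meas_Y1 h_bin_Y1)
      (integrable_of_forall_eq_zero_or_one _ h_meas_Y0 h_bin_Y0),
    integral_eq_pr_of_forall_eq_zero_or_one _ h_meas_Y1 h_bin_Y1,
    integral_eq_pr_of_forall_eq_zero_or_one _ h_meas_Y0 h_bin_Y0]
  rfl
end

section
/- Let S, S', Q, Q' be binary (0/1) random variables such that P(S'=s | S=s, Q', Q) = P(S'=s | S=s) for s=0,1 (S' is independent of (Q,Q') given S) and P(Q'=q | Q=q, S', S) = P(Q'=q | Q=q) =: b_q for q=0,1 (Q' is independent of (S,S') given Q). Set a_s := P(S=s | S'=s) for s=0,1. If all conditioning events have positive probability, a_1+a_0−1 ≠ 0, and b_1+b_0−1 ≠ 0, then P(Q=1|S=1) = [a_0·P(Q'=1|S'=1) − (1−a_1)·P(Q'=1|S'=0)] / [(a_1+a_0−1)(b_1+b_0−1)] − (1−b_0)/(b_1+b_0−1), and P(Q=1|S=0) = [a_1·P(Q'=1|S'=0) − (1−a_0)·P(Q'=1|S'=1)] / [(a_1+a_0−1)(b_1+b_0−1)] − (1−b_0)/(b_1+b_0−1). -/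
open MeasureTheory ProbabilityTheory

section Helpers

variable {Ω : Type*} [MeasurableSpace Ω] {μ : MeasureTheory.Measure Ω}

lemma cpr_mul_real [IsFiniteMeasure μ] {B : Set Ω} (hB : MeasurableSet B) (A : Set Ω) :
    cpr μ B A * μ.real B = μ.real (B ∩ A) := by
  rw [cpr, measureReal_def, measureReal_def, ← ENNReal.toReal_mul,
    ProbabilityTheory.cond_mul_eq_inter hB]

/-- The event `A` splits along the two values of a binary variable. -/
lemma real_inter_zero_add_inter_one [IsFiniteMeasure μ] {X : Ω → ℝ} (hX : Measurable X)
    (hbin : ∀ ω, X ω = 0 ∨ X ω = 1) (A : Set Ω) :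
    μ.real (A ∩ {ω | X ω = 0}) + μ.real (A ∩ {ω | X ω = 1}) = μ.real A := by
  have hone : {ω | X ω = 1} = {ω | X ω = 0}ᶜ := by
    ext ω
    rcases hbin ω with h | h <;> simp [h]
  rw [hone, ← Set.sdiff_eq]
  exact measureReal_inter_add_sdiff (s := A) (hX (measurableSet_singleton 0))

/-- Proportionality on both slices of a binary variable passes to the whole event. -/
lemma real_inter_eq_mul_of_slices [IsFiniteMeasure μ] {X : Ω → ℝ} (hX : Measurable X)
    (hbin : ∀ ω, X ω = 0 ∨ X ω = 1) {A T : Set Ω} {k : ℝ}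
    (h : ∀ x ∈ bin01, μ.real (A ∩ {ω | X ω = x} ∩ T) = k * μ.real (A ∩ {ω | X ω = x})) :
    μ.real (A ∩ T) = k * μ.real A := by
  have h0 := h 0 (by simp [bin01])
  have h1 := h 1 (by simp [bin01])
  have e1 := real_inter_zero_add_inter_one (μ := μ) hX hbin A
  have e2 := real_inter_zero_add_inter_one (μ := μ) hX hbin (A ∩ T)
  rw [Set.inter_right_comm A T, Set.inter_right_comm A T, h0, h1] at e2
  rw [← e2, ← e1]
  ring

end Helpers

set_option maxHeartbeats 1000000 in
theorem stmt1 {Ω : Type*} [MeasurableSpace Ω]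
    (μ : MeasureTheory.Measure Ω) [IsProbabilityMeasure μ]
    (S S' Q Q' : Ω → ℝ)
    (h_meas_S : Measurable S)
    (h_meas_Sp : Measurable S')
    (h_meas_Q : Measurable Q)
    (h_meas_Qp : Measurable Q')
    (h_bin_S : ∀ ω, S ω = 0 ∨ S ω = 1)
    (h_bin_Sp : ∀ ω, S' ω = 0 ∨ S' ω = 1)
    (h_bin_Q : ∀ ω, Q ω = 0 ∨ Q ω = 1)
    (h_bin_Qp : ∀ ω, Q' ω = 0 ∨ Q' ω = 1)
    (h_pos1 : ∀ s ∈ bin01, ∀ q ∈ bin01, ∀ q' ∈ bin01,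
      μ ({ω | S ω = s} ∩ {ω | Q ω = q} ∩ {ω | Q' ω = q'}) ≠ 0)
    (h_pos2 : ∀ s ∈ bin01, ∀ s' ∈ bin01, ∀ q ∈ bin01,
      μ ({ω | S ω = s} ∩ {ω | S' ω = s'} ∩ {ω | Q ω = q}) ≠ 0)
    (h_ndS : ∀ s ∈ bin01, ∀ q ∈ bin01, ∀ q' ∈ bin01,
      cpr μ ({ω | S ω = s} ∩ {ω | Q ω = q} ∩ {ω | Q' ω = q'}) {ω | S' ω = s}
        = cpr μ {ω | S ω = s} {ω | S' ω = s})
    (h_ndQ : ∀ q ∈ bin01, ∀ s ∈ bin01, ∀ s' ∈ bin01,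
      cpr μ ({ω | Q ω = q} ∩ {ω | S ω = s} ∩ {ω | S' ω = s'}) {ω | Q' ω = q}
        = cpr μ {ω | Q ω = q} {ω | Q' ω = q})
    (a1 a0 b1 b0 : ℝ)
    (h_a1 : a1 = cpr μ {ω | S' ω = 1} {ω | S ω = 1})
    (h_a0 : a0 = cpr μ {ω | S' ω = 0} {ω | S ω = 0})
    (h_b1 : b1 = cpr μ {ω | Q ω = 1} {ω | Q' ω = 1})
    (h_b0 : b0 = cpr μ {ω | Q ω = 0} {ω | Q' ω = 0})
    (h_ra : a1 + a0 - 1 ≠ 0) (h_rb : b1 + b0 - 1 ≠ 0) :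
    cpr μ {ω | S ω = 1} {ω | Q ω = 1}
      = (a0 * cpr μ {ω | S' ω = 1} {ω | Q' ω = 1}
            - (1 - a1) * cpr μ {ω | S' ω = 0} {ω | Q' ω = 1})
          / ((a1 + a0 - 1) * (b1 + b0 - 1))
        - (1 - b0) / (b1 + b0 - 1)
    ∧ cpr μ {ω | S ω = 0} {ω | Q ω = 1}
      = (a1 * cpr μ {ω | S' ω = 0} {ω | Q' ω = 1}
            - (1 - a0) * cpr μ {ω | S' ω = 1} {ω | Q' ω = 1})
          / ((a1 + a0 - 1) * (b1 + b0 - 1))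
        - (1 - b0) / (b1 + b0 - 1) := by
  have z : (0 : ℝ) ∈ bin01 := by simp [bin01]
  have o : (1 : ℝ) ∈ bin01 := by simp [bin01]
  have ms (X : Ω → ℝ) (hX : Measurable X) (x : ℝ) : MeasurableSet {ω | X ω = x} :=
    hX (measurableSet_singleton x)
  have mS := ms S h_meas_S
  have mT := ms S' h_meas_Sp
  have mQ := ms Q h_meas_Q
  have splitS := real_inter_zero_add_inter_one (μ := μ) h_meas_S h_bin_S
  have splitT := real_inter_zero_add_inter_one (μ := μ) h_meas_Sp h_bin_Sp
  have splitQ := real_inter_zero_add_inter_one (μ := μ) h_meas_Q h_bin_Q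
  have splitR := real_inter_zero_add_inter_one (μ := μ) h_meas_Qp h_bin_Qp
  have posS : ∀ s ∈ bin01, μ.real {ω | S ω = s} ≠ 0 := by
    intro s hs h
    rw [measureReal_eq_zero_iff] at h
    exact h_pos1 s hs 0 z 0 z (measure_mono_null (fun ω hω => hω.1.1) h)
  have posT : ∀ t ∈ bin01, μ.real {ω | S' ω = t} ≠ 0 := by
    intro t ht h
    rw [measureReal_eq_zero_iff] at h
    exact h_pos2 0 z t ht 0 z (measure_mono_null (fun ω hω => hω.1.2) h)
  have flipS : ∀ s ∈ bin01, ∀ q ∈ bin01,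
      μ.real ({ω | S ω = s} ∩ {ω | Q ω = q} ∩ {ω | S' ω = s})
        = cpr μ {ω | S ω = s} {ω | S' ω = s} * μ.real ({ω | S ω = s} ∩ {ω | Q ω = q}) := by
    intro s hs q hq
    refine real_inter_eq_mul_of_slices h_meas_Qp h_bin_Qp fun r hr => ?_
    rw [← h_ndS s hs q hq r hr,
      cpr_mul_real (((mS s).inter (mQ q)).inter (ms Q' h_meas_Qp r))]
  have flipS' : ∀ s ∈ bin01, μ.real ({ω | S ω = s} ∩ {ω | S' ω = s})
      = cpr μ {ω | S ω = s} {ω | S' ω = s} * μ.real {ω | S ω = s} :=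
    fun s _ => (cpr_mul_real (mS s) _).symm
  have flipQ : ∀ q ∈ bin01, ∀ s ∈ bin01, ∀ t ∈ bin01,
      μ.real ({ω | Q ω = q} ∩ {ω | S ω = s} ∩ {ω | S' ω = t} ∩ {ω | Q' ω = q})
        = cpr μ {ω | Q ω = q} {ω | Q' ω = q}
          * μ.real ({ω | S ω = s} ∩ {ω | S' ω = t} ∩ {ω | Q ω = q}) := by
    intro q hq s hs t ht
    rw [← h_ndQ q hq s hs t ht, ← Set.inter_comm {ω | Q ω = q}, ← Set.inter_assoc,
      cpr_mul_real (((mQ q).inter (mS s)).inter (mT t))]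
  -- `S'` is independent of `Q` given `S`.
  have indep : ∀ s ∈ bin01, ∀ t ∈ bin01, ∀ q ∈ bin01,
      μ.real ({ω | S ω = s} ∩ {ω | S' ω = t} ∩ {ω | Q ω = q}) * μ.real {ω | S ω = s}
        = μ.real ({ω | S ω = s} ∩ {ω | S' ω = t}) * μ.real ({ω | S ω = s} ∩ {ω | Q ω = q}) := by
    intro s hs t ht q hq
    have h1 := flipS s hs q hq
    have h2 := flipS' s hs
    have h3 := splitT ({ω | S ω = s} ∩ {ω | Q ω = q})
    have h4 := splitT {ω | S ω = s}
    rw [Set.inter_right_comm]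
    rcases hs with rfl | rfl <;> rcases ht with rfl | rfl
    · rw [h1, h2]; ring
    · rw [← eq_sub_iff_add_eq'] at h3 h4
      rw [h3, h4, h1, h2]; ring
    · rw [← eq_sub_iff_add_eq] at h3 h4
      rw [h3, h4, h1, h2]; ring
    · rw [h1, h2]; ring
  have obs : ∀ s ∈ bin01, ∀ t ∈ bin01,
      μ.real ({ω | S' ω = t} ∩ {ω | Q' ω = 1} ∩ {ω | S ω = s})
        = b1 * μ.real ({ω | S ω = s} ∩ {ω | S' ω = t} ∩ {ω | Q ω = 1})
          + (1 - b0) * μ.real ({ω | S ω = s} ∩ {ω | S' ω = t} ∩ {ω | Q ω = 0}) := by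
    intro s hs t ht
    have h1 := flipQ 1 o s hs t ht
    have h0 := flipQ 0 z s hs t ht
    have h := splitQ ({ω | S' ω = t} ∩ {ω | Q' ω = 1} ∩ {ω | S ω = s})
    have h' := splitR ({ω | Q ω = 0} ∩ {ω | S ω = s} ∩ {ω | S' ω = t})
    have e (q : ℝ) : {ω | S' ω = t} ∩ {ω | Q' ω = 1} ∩ {ω | S ω = s} ∩ {ω | Q ω = q}
        = {ω | Q ω = q} ∩ {ω | S ω = s} ∩ {ω | S' ω = t} ∩ {ω | Q' ω = 1} := by
      ext ω; simp only [Set.mem_inter_iff]; tauto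
    have e' : {ω | Q ω = 0} ∩ {ω | S ω = s} ∩ {ω | S' ω = t}
        = {ω | S ω = s} ∩ {ω | S' ω = t} ∩ {ω | Q ω = 0} := by
      ext ω; simp only [Set.mem_inter_iff]; tauto
    rw [e, e] at h
    rw [← h_b1] at h1
    rw [← h_b0] at h0
    rw [h0, e'] at h'
    rw [e'] at h
    linarith
  have cprS : ∀ s ∈ bin01, ∀ A, cpr μ {ω | S ω = s} A
      = μ.real ({ω | S ω = s} ∩ A) / μ.real {ω | S ω = s} :=
    fun s hs A => eq_div_of_mul_eq (posS s hs) (cpr_mul_real (mS s) A)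
  have cprT : ∀ t ∈ bin01, ∀ A, cpr μ {ω | S' ω = t} A
      = μ.real ({ω | S' ω = t} ∩ A) / μ.real {ω | S' ω = t} :=
    fun t ht A => eq_div_of_mul_eq (posT t ht) (cpr_mul_real (mT t) A)
  -- The law of `Q'` given `S = s`, `S' = t` does not depend on `t`.
  have mix : ∀ s ∈ bin01, ∀ t ∈ bin01,
      μ.real ({ω | S' ω = t} ∩ {ω | Q' ω = 1} ∩ {ω | S ω = s})
        = μ.real ({ω | S' ω = t} ∩ {ω | S ω = s})
          * ((1 - b0) + (b1 + b0 - 1) * cpr μ {ω | S ω = s} {ω | Q ω = 1}) := by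
    intro s hs t ht
    have hp := posS s hs
    have i0 := indep s hs t ht 0 z
    have i1 := indep s hs t ht 1 o
    have hq := splitQ {ω | S ω = s}
    rw [obs s hs t ht, cprS s hs, Set.inter_comm {ω | S' ω = t}]
    rw [← eq_sub_iff_add_eq] at hq
    rw [hq] at i0
    field_simp
    linear_combination b1 * i1 + (1 - b0) * i0
  have total : ∀ t ∈ bin01, cpr μ {ω | S' ω = t} {ω | Q' ω = 1}
      = cpr μ {ω | S' ω = t} {ω | S ω = 0}
          * ((1 - b0) + (b1 + b0 - 1) * cpr μ {ω | S ω = 0} {ω | Q ω = 1})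
        + cpr μ {ω | S' ω = t} {ω | S ω = 1}
          * ((1 - b0) + (b1 + b0 - 1) * cpr μ {ω | S ω = 1} {ω | Q ω = 1}) := by
    intro t ht
    rw [cprT t ht, cprT t ht, cprT t ht, ← splitS, mix 0 z t ht, mix 1 o t ht]
    ring
  have compl : ∀ t ∈ bin01,
      cpr μ {ω | S' ω = t} {ω | S ω = 0} + cpr μ {ω | S' ω = t} {ω | S ω = 1} = 1 := by
    intro t ht
    rw [cprT t ht, cprT t ht, ← add_div, splitS, div_self (posT t ht)]
  have c0 := compl 0 z
  have c1 := compl 1 o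
  rw [← h_a0, ← eq_sub_iff_add_eq'] at c0
  rw [← h_a1, ← eq_sub_iff_add_eq] at c1
  rw [total 0 z, total 1 o, c0, c1, ← h_a0, ← h_a1]
  constructor <;> field_simp <;> ring
end

section
/- Let S, S', Q, Q' be binary (0/1) random variables such that P(S'=s | S=s, Q', Q) = P(S'=s | S=s) for s=0,1 and P(Q'=q | Q=q, S', S) = P(Q'=q | Q=q) =: b_q for q=0,1. Set a_s := P(S=s | S'=s) for s=0,1. If all conditioning events have positive probability, then RD_{Q'|S'} = (a_1+a_0−1)(b_1+b_0−1)·RD_{Q|S}. -/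
open MeasureTheory ProbabilityTheory

theorem measureReal_eq_inter_zero_add_inter_one {Ω : Type*} [MeasurableSpace Ω]
    (μ : Measure Ω) [IsFiniteMeasure μ] {X : Ω → ℝ} (hX : Measurable X)
    (hbin : ∀ ω, X ω = 0 ∨ X ω = 1) (A : Set Ω) :
    μ.real A = μ.real (A ∩ {ω | X ω = 0}) + μ.real (A ∩ {ω | X ω = 1}) := by
  rw [← measureReal_inter_add_sdiff (μ := μ) (s := A) (hX (measurableSet_singleton (0 : ℝ)))]
  congr 2
  ext ω
  rcases hbin ω with h | h <;> simp [h]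

theorem cpr_eq_div {Ω : Type*} [MeasurableSpace Ω] (μ : Measure Ω) {B : Set Ω}
    (hB : MeasurableSet B) (A : Set Ω) : cpr μ B A = μ.real (B ∩ A) / μ.real B := by
  rw [cpr, cond_apply hB, ENNReal.toReal_mul, ENNReal.toReal_inv, measureReal_def,
    measureReal_def, div_eq_inv_mul]

/-- The risk difference identity in terms of the joint masses `x s q`. -/
theorem riskDifference_misclassified {b1 b0 c1 c0 x11 x10 x01 x00 n1 n0 : ℝ}
    (hn1 : n1 = c1 * (x10 + x11) + (1 - c0) * (x00 + x01))
    (hn0 : n0 = (1 - c1) * (x10 + x11) + c0 * (x00 + x01))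
    (h1 : n1 ≠ 0) (h0 : n0 ≠ 0) (hX1 : x10 + x11 ≠ 0) (hX0 : x00 + x01 ≠ 0) :
    (b1 * (c1 * x11 + (1 - c0) * x01) + (1 - b0) * (c1 * x10 + (1 - c0) * x00)) / n1
      - (b1 * ((1 - c1) * x11 + c0 * x01) + (1 - b0) * ((1 - c1) * x10 + c0 * x00)) / n0
    = (c1 * (x10 + x11) / n1 + c0 * (x00 + x01) / n0 - 1) * (b1 + b0 - 1)
      * (x11 / (x10 + x11) - x01 / (x00 + x01)) := by
  field_simp
  subst hn1 hn0
  ring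

set_option maxHeartbeats 1000000 in
theorem stmt2 {Ω : Type*} [MeasurableSpace Ω]
    (μ : MeasureTheory.Measure Ω) [IsProbabilityMeasure μ]
    (S S' Q Q' : Ω → ℝ)
    (h_meas_S : Measurable S)
    (h_meas_Sp : Measurable S')
    (h_meas_Q : Measurable Q)
    (h_meas_Qp : Measurable Q')
    (h_bin_S : ∀ ω, S ω = 0 ∨ S ω = 1)
    (h_bin_Sp : ∀ ω, S' ω = 0 ∨ S' ω = 1)
    (h_bin_Q : ∀ ω, Q ω = 0 ∨ Q ω = 1)
    (h_bin_Qp : ∀ ω, Q' ω = 0 ∨ Q' ω = 1)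
    (h_pos1 : ∀ s ∈ bin01, ∀ q ∈ bin01, ∀ q' ∈ bin01,
      μ ({ω | S ω = s} ∩ {ω | Q ω = q} ∩ {ω | Q' ω = q'}) ≠ 0)
    (h_pos2 : ∀ s ∈ bin01, ∀ s' ∈ bin01, ∀ q ∈ bin01,
      μ ({ω | S ω = s} ∩ {ω | S' ω = s'} ∩ {ω | Q ω = q}) ≠ 0)
    (h_ndS : ∀ s ∈ bin01, ∀ q ∈ bin01, ∀ q' ∈ bin01,
      cpr μ ({ω | S ω = s} ∩ {ω | Q ω = q} ∩ {ω | Q' ω = q'}) {ω | S' ω = s}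
        = cpr μ {ω | S ω = s} {ω | S' ω = s})
    (h_ndQ : ∀ q ∈ bin01, ∀ s ∈ bin01, ∀ s' ∈ bin01,
      cpr μ ({ω | Q ω = q} ∩ {ω | S ω = s} ∩ {ω | S' ω = s'}) {ω | Q' ω = q}
        = cpr μ {ω | Q ω = q} {ω | Q' ω = q})
    (a1 a0 b1 b0 : ℝ)
    (h_a1 : a1 = cpr μ {ω | S' ω = 1} {ω | S ω = 1})
    (h_a0 : a0 = cpr μ {ω | S' ω = 0} {ω | S ω = 0})
    (h_b1 : b1 = cpr μ {ω | Q ω = 1} {ω | Q' ω = 1})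
    (h_b0 : b0 = cpr μ {ω | Q ω = 0} {ω | Q' ω = 0})
    :
    cpr μ {ω | S' ω = 1} {ω | Q' ω = 1} - cpr μ {ω | S' ω = 0} {ω | Q' ω = 1}
      = (a1 + a0 - 1) * (b1 + b0 - 1)
        * (cpr μ {ω | S ω = 1} {ω | Q ω = 1} - cpr μ {ω | S ω = 0} {ω | Q ω = 1}) := by
  have mS (s : ℝ) : MeasurableSet {ω | S ω = s} := h_meas_S (measurableSet_singleton s)
  have mS' (s : ℝ) : MeasurableSet {ω | S' ω = s} := h_meas_Sp (measurableSet_singleton s)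
  have mQ (q : ℝ) : MeasurableSet {ω | Q ω = q} := h_meas_Q (measurableSet_singleton q)
  have mQ' (q : ℝ) : MeasurableSet {ω | Q' ω = q} := h_meas_Qp (measurableSet_singleton q)
  have z : (0 : ℝ) ∈ bin01 := by simp [bin01]
  have o : (1 : ℝ) ∈ bin01 := by simp [bin01]
  have splitS := measureReal_eq_inter_zero_add_inter_one μ h_meas_S h_bin_S
  have splitS' := measureReal_eq_inter_zero_add_inter_one μ h_meas_Sp h_bin_Sp
  have splitQ := measureReal_eq_inter_zero_add_inter_one μ h_meas_Q h_bin_Q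
  have splitQ' := measureReal_eq_inter_zero_add_inter_one μ h_meas_Qp h_bin_Qp
  let t (s s' q : ℝ) : ℝ := μ.real ({ω | S ω = s} ∩ {ω | S' ω = s'} ∩ {ω | Q ω = q})
  let x (s q : ℝ) : ℝ := μ.real ({ω | S ω = s} ∩ {ω | Q ω = q})
  let c (s : ℝ) : ℝ := cpr μ {ω | S ω = s} {ω | S' ω = s}
  have tpos {s s' q : ℝ} (hs : s ∈ bin01) (hs' : s' ∈ bin01) (hq : q ∈ bin01) : 0 < t s s' q :=
    ENNReal.toReal_pos (h_pos2 s hs s' hs' q hq) (measure_ne_top _ _)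
  have hx (s q : ℝ) : x s q = t s 0 q + t s 1 q := by
    simp only [x, t, splitS' ({ω | S ω = s} ∩ {ω | Q ω = q}), Set.inter_right_comm]
  have hX (s : ℝ) : μ.real {ω | S ω = s} = x s 0 + x s 1 := splitQ _
  have hSS' (s s' : ℝ) : μ.real ({ω | S' ω = s'} ∩ {ω | S ω = s}) = t s s' 0 + t s s' 1 := by
    rw [Set.inter_comm]
    exact splitQ _
  have hn (s' : ℝ) : μ.real {ω | S' ω = s'}
      = (t 0 s' 0 + t 0 s' 1) + (t 1 s' 0 + t 1 s' 1) := by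
    rw [splitS, hSS', hSS']
  have ht {s q : ℝ} (hs : s ∈ bin01) (hq : q ∈ bin01) : t s s q = c s * x s q := by
    have key {q' : ℝ} (hq' : q' ∈ bin01) :
        μ.real ({ω | S ω = s} ∩ {ω | S' ω = s} ∩ {ω | Q ω = q} ∩ {ω | Q' ω = q'})
          = c s * μ.real ({ω | S ω = s} ∩ {ω | Q ω = q} ∩ {ω | Q' ω = q'}) := by
      have pos : 0 < μ.real ({ω | S ω = s} ∩ {ω | Q ω = q} ∩ {ω | Q' ω = q'}) :=
        ENNReal.toReal_pos (h_pos1 s hs q hq q' hq') (measure_ne_top _ _)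
      have h := h_ndS s hs q hq q' hq'
      rw [cpr_eq_div μ (((mS s).inter (mQ q)).inter (mQ' q')),
        div_eq_iff pos.ne'] at h
      rw [← h]
      congr 1
      ext ω
      simp only [Set.mem_inter_iff]
      tauto
    change μ.real _ = c s * μ.real _
    rw [splitQ', splitQ' ({ω | S ω = s} ∩ {ω | Q ω = q}), key z, key o, mul_add]
  have hu {s s' q : ℝ} (hs : s ∈ bin01) (hs' : s' ∈ bin01) (hq : q ∈ bin01) :
      μ.real ({ω | S ω = s} ∩ {ω | S' ω = s'} ∩ {ω | Q ω = q} ∩ {ω | Q' ω = q})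
        = cpr μ {ω | Q ω = q} {ω | Q' ω = q} * t s s' q := by
    have e : {ω | Q ω = q} ∩ {ω | S ω = s} ∩ {ω | S' ω = s'}
        = {ω | S ω = s} ∩ {ω | S' ω = s'} ∩ {ω | Q ω = q} := by
      rw [Set.inter_assoc, Set.inter_comm]
    have h := h_ndQ q hq s hs s' hs'
    rwa [e, cpr_eq_div μ (((mS s).inter (mS' s')).inter (mQ q)),
      div_eq_iff (tpos hs hs' hq).ne'] at h
  have hS'Q' {s' : ℝ} (hs' : s' ∈ bin01) : μ.real ({ω | S' ω = s'} ∩ {ω | Q' ω = 1})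
      = b1 * (t 1 s' 1 + t 0 s' 1) + (1 - b0) * (t 1 s' 0 + t 0 s' 0) := by
    have aux {s : ℝ} (hs : s ∈ bin01) :
        μ.real ({ω | S' ω = s'} ∩ {ω | Q' ω = 1} ∩ {ω | S ω = s})
          = b1 * t s s' 1 + (1 - b0) * t s s' 0 := by
      have e : {ω | S' ω = s'} ∩ {ω | Q' ω = 1} ∩ {ω | S ω = s}
          = {ω | S ω = s} ∩ {ω | S' ω = s'} ∩ {ω | Q' ω = 1} := by
        rw [Set.inter_right_comm, Set.inter_comm {ω | S' ω = s'}]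
      have h1 := hu hs hs' o
      have h0 := hu hs hs' z
      have h2 : t s s' 0 = _ := splitQ' _
      rw [← h_b1] at h1
      rw [← h_b0] at h0
      rw [e, splitQ, Set.inter_right_comm, Set.inter_right_comm _ _ {ω | Q ω = 1}]
      linarith
    rw [splitS, aux z, aux o]
    ring
  have t11 {q : ℝ} (hq : q ∈ bin01) : t 1 1 q = c 1 * x 1 q := ht o hq
  have t00 {q : ℝ} (hq : q ∈ bin01) : t 0 0 q = c 0 * x 0 q := ht z hq
  have t10 {q : ℝ} (hq : q ∈ bin01) : t 1 0 q = (1 - c 1) * x 1 q := by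
    linarith [hx 1 q, t11 hq]
  have t01 {q : ℝ} (hq : q ∈ bin01) : t 0 1 q = (1 - c 0) * x 0 q := by
    linarith [hx 0 q, t00 hq]
  have xpos {s q : ℝ} (hs : s ∈ bin01) (hq : q ∈ bin01) : 0 < x s q := by
    rw [hx]
    exact add_pos (tpos hs z hq) (tpos hs o hq)
  have npos {s' : ℝ} (hs' : s' ∈ bin01) : 0 < μ.real {ω | S' ω = s'} := by
    rw [hn]
    linarith [tpos z hs' z, tpos z hs' o, tpos o hs' z, tpos o hs' o]
  have hn1 : μ.real {ω | S' ω = 1} = c 1 * (x 1 0 + x 1 1) + (1 - c 0) * (x 0 0 + x 0 1) := by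
    rw [hn, t11 z, t11 o, t01 z, t01 o]
    ring
  have hn0 : μ.real {ω | S' ω = 0} = (1 - c 1) * (x 1 0 + x 1 1) + c 0 * (x 0 0 + x 0 1) := by
    rw [hn, t10 z, t10 o, t00 z, t00 o]
    ring
  rw [h_a1, h_a0, cpr_eq_div μ (mS' 1), cpr_eq_div μ (mS' 0), cpr_eq_div μ (mS' 1),
    cpr_eq_div μ (mS' 0), cpr_eq_div μ (mS 1), cpr_eq_div μ (mS 0), hS'Q' o, hS'Q' z,
    hSS', hSS', hX, hX, t11 z, t11 o, t10 z, t10 o, t01 z, t01 o, t00 z, t00 o,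
    ← mul_add, ← mul_add]
  exact riskDifference_misclassified hn1 hn0 (npos o).ne' (npos z).ne'
    (add_pos (xpos o z) (xpos o o)).ne' (add_pos (xpos z z) (xpos z o)).ne'
end

section
/- Suppose Assumption 1 holds, only Y is mismeasured (Z'=Z and D'=D almost surely), the measurement error of Y is non-differential with respect to the potential values (Y' is independent of (Z, D_1, D_0, Y_1, Y_0) given Y), all conditioning events have positive probability, P(U=u) > 0 for u=a,n,c, and r_Y > 0. Then the following testable inequalities hold: P(Y'=y, D=1 | Z=1) ≥ P(Y'=y, D=1 | Z=0) for y=0,1, and P(Y'=y, D=0 | Z=0) ≥ P(Y'=y, D=0 | Z=1) for y=0,1. -/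
open MeasureTheory ProbabilityTheory

section BinaryPartition

variable {Ω : Type*} [MeasurableSpace Ω] (μ : Measure Ω)

lemma cpr_eq_inv_mul {B : Set Ω} (hB : MeasurableSet B) (A : Set Ω) :
    cpr μ B A = (pr μ B)⁻¹ * pr μ (B ∩ A) := by
  simp [cpr, pr, cond_apply hB, ENNReal.toReal_mul, ENNReal.toReal_inv]

lemma cpr_nonneg (B A : Set Ω) : 0 ≤ cpr μ B A := ENNReal.toReal_nonneg

lemma pr_nonneg (A : Set Ω) : 0 ≤ pr μ A := ENNReal.toReal_nonneg

variable [IsFiniteMeasure μ]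

lemma pr_eq_zero_iff {A : Set Ω} : pr μ A = 0 ↔ μ A = 0 := by
  simp [pr, ENNReal.toReal_eq_zero_iff]

lemma pr_inter_eq_cpr_mul {B : Set Ω} (hB : MeasurableSet B) (A : Set Ω) :
    pr μ (B ∩ A) = cpr μ B A * pr μ B := by
  by_cases h : pr μ B = 0
  · rw [h, mul_zero, pr_eq_zero_iff]
    exact measure_mono_null Set.inter_subset_left ((pr_eq_zero_iff μ).1 h)
  · rw [cpr_eq_inv_mul μ hB]
    field_simp

/-- The probability of an event, split along the values of a binary variable. -/
lemma pr_split {X : Ω → ℝ} (hX : Measurable X) (hb : ∀ ω, X ω = 0 ∨ X ω = 1) (A : Set Ω) :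
    pr μ A = pr μ (A ∩ {ω | X ω = 0}) + pr μ (A ∩ {ω | X ω = 1}) := by
  have h := measureReal_inter_add_sdiff (μ := μ) (s := A) (hX (measurableSet_singleton (0 : ℝ)))
  have e : A \ X ⁻¹' {0} = A ∩ {ω | X ω = 1} := by
    ext ω
    rcases hb ω with h | h <;> simp [h]
  rw [e] at h
  exact h.symm

/-- The probability of an event, split along the values of two binary variables. -/
lemma pr_split₂ {X W : Ω → ℝ} (hX : Measurable X) (hbX : ∀ ω, X ω = 0 ∨ X ω = 1)
    (hW : Measurable W) (hbW : ∀ ω, W ω = 0 ∨ W ω = 1) (A : Set Ω) :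
    pr μ A = pr μ (A ∩ {ω | X ω = 0} ∩ {ω | W ω = 0}) + pr μ (A ∩ {ω | X ω = 0} ∩ {ω | W ω = 1})
      + (pr μ (A ∩ {ω | X ω = 1} ∩ {ω | W ω = 0})
        + pr μ (A ∩ {ω | X ω = 1} ∩ {ω | W ω = 1})) := by
  rw [pr_split μ hX hbX A, pr_split μ hW hbW (A ∩ {ω | X ω = 0}),
    pr_split μ hW hbW (A ∩ {ω | X ω = 1})]

/-- Two binary variables with the same conditional law given `B` have equally likely
off-diagonal values on `B`. -/
lemma pr_off_diagonal_eq {X W : Ω → ℝ} (hX : Measurable X) (hbX : ∀ ω, X ω = 0 ∨ X ω = 1)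
    (hW : Measurable W) (hbW : ∀ ω, W ω = 0 ∨ W ω = 1) {B : Set Ω} (hB : MeasurableSet B)
    (h : cpr μ B {ω | X ω = 1} = cpr μ B {ω | W ω = 1}) :
    pr μ (B ∩ {ω | X ω = 1} ∩ {ω | W ω = 0}) = pr μ (B ∩ {ω | X ω = 0} ∩ {ω | W ω = 1}) := by
  have h' : pr μ (B ∩ {ω | X ω = 1}) = pr μ (B ∩ {ω | W ω = 1}) := by
    rw [pr_inter_eq_cpr_mul μ hB, pr_inter_eq_cpr_mul μ hB, h]
  rw [pr_split μ hW hbW, pr_split μ hX hbX (B ∩ {ω | W ω = 1}),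
    Set.inter_right_comm B {ω | W ω = 1} {ω | X ω = 0},
    Set.inter_right_comm B {ω | W ω = 1} {ω | X ω = 1}] at h'
  linarith

end BinaryPartition

set_option maxHeartbeats 1000000 in
theorem stmt6 {Ω : Type*} [MeasurableSpace Ω]
    (μ : MeasureTheory.Measure Ω) [IsProbabilityMeasure μ]
    (Z D Y Y' D1 D0 Y1 Y0 : Ω → ℝ)
    (h_meas_Z : Measurable Z)
    (h_meas_D : Measurable D)
    (h_meas_Y : Measurable Y)
    (h_meas_Yp : Measurable Y')
    (h_meas_D1 : Measurable D1)
    (h_meas_D0 : Measurable D0)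
    (h_meas_Y1 : Measurable Y1)
    (h_meas_Y0 : Measurable Y0)
    (h_bin_Z : ∀ ω, Z ω = 0 ∨ Z ω = 1)
    (h_bin_Yp : ∀ ω, Y' ω = 0 ∨ Y' ω = 1)
    (h_bin_D1 : ∀ ω, D1 ω = 0 ∨ D1 ω = 1)
    (h_bin_D0 : ∀ ω, D0 ω = 0 ∨ D0 ω = 1)
    (h_bin_Y1 : ∀ ω, Y1 ω = 0 ∨ Y1 ω = 1)
    (h_bin_Y0 : ∀ ω, Y0 ω = 0 ∨ Y0 ω = 1)
    (h_consD : ∀ ω, D ω = Z ω * D1 ω + (1 - Z ω) * D0 ω)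
    (h_consY : ∀ ω, Y ω = Z ω * Y1 ω + (1 - Z ω) * Y0 ω)
    (h_indep : IndepFun Z (fun ω => (Y1 ω, Y0 ω, D1 ω, D0 ω)) μ)
    (h_mono : ∀ᵐ ω ∂μ, D0 ω ≤ D1 ω)
    (h_exclA : cpr μ {ω | D1 ω = 1 ∧ D0 ω = 1} {ω | Y1 ω = 1}
        = cpr μ {ω | D1 ω = 1 ∧ D0 ω = 1} {ω | Y0 ω = 1})
    (h_exclN : cpr μ {ω | D1 ω = 0 ∧ D0 ω = 0} {ω | Y1 ω = 1}
        = cpr μ {ω | D1 ω = 0 ∧ D0 ω = 0} {ω | Y0 ω = 1})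
    (h_ndY : ∀ y ∈ bin01, ∀ y' ∈ bin01, ∀ z ∈ bin01, ∀ d1 ∈ bin01, ∀ d0 ∈ bin01, ∀ y1 ∈ bin01, ∀ y0 ∈ bin01,
      μ ({ω | Y ω = y} ∩ {ω | Z ω = z} ∩ {ω | D1 ω = d1} ∩ {ω | D0 ω = d0} ∩ {ω | Y1 ω = y1} ∩ {ω | Y0 ω = y0}) ≠ 0 →
      cpr μ ({ω | Y ω = y} ∩ {ω | Z ω = z} ∩ {ω | D1 ω = d1} ∩ {ω | D0 ω = d0} ∩ {ω | Y1 ω = y1} ∩ {ω | Y0 ω = y0}) {ω | Y' ω = y'}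
        = cpr μ {ω | Y ω = y} {ω | Y' ω = y'})
    (h_posDZ : ∀ d ∈ bin01, ∀ z ∈ bin01,
      μ ({ω | D ω = d} ∩ {ω | Z ω = z}) ≠ 0)
    (h_posY : ∀ y ∈ bin01, μ {ω | Y ω = y} ≠ 0)
    (h_Ua : 0 < pr μ {ω | D1 ω = 1 ∧ D0 ω = 1})
    (h_Un : 0 < pr μ {ω | D1 ω = 0 ∧ D0 ω = 0})
    (h_Uc : 0 < pr μ {ω | D1 ω = 1 ∧ D0 ω = 0})
    (SNY SPY : ℝ)
    (h_SNY : SNY = cpr μ {ω | Y ω = 1} {ω | Y' ω = 1})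
    (h_SPY : SPY = cpr μ {ω | Y ω = 0} {ω | Y' ω = 0})
    (h_rY : 0 < SNY + SPY - 1) :
    ∀ y ∈ bin01,
      cpr μ {ω | Z ω = 0} ({ω | Y' ω = y} ∩ {ω | D ω = 1})
        ≤ cpr μ {ω | Z ω = 1} ({ω | Y' ω = y} ∩ {ω | D ω = 1})
      ∧ cpr μ {ω | Z ω = 1} ({ω | Y' ω = y} ∩ {ω | D ω = 0})
        ≤ cpr μ {ω | Z ω = 0} ({ω | Y' ω = y} ∩ {ω | D ω = 0}) := by
  intro y hy
  have m0 : (0 : ℝ) ∈ bin01 := by simp [bin01]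
  have m1 : (1 : ℝ) ∈ bin01 := by simp [bin01]
  have meas : ∀ {X : Ω → ℝ}, Measurable X → ∀ x : ℝ, MeasurableSet {ω | X ω = x} :=
    fun hX x => hX (measurableSet_singleton x)
  let cell : ℝ → ℝ → ℝ → ℝ → Set Ω := fun d1 d0 y1 y0 =>
    {ω | D1 ω = d1 ∧ D0 ω = d0} ∩ {ω | Y1 ω = y1} ∩ {ω | Y0 ω = y0}
  let q : ℝ → ℝ := fun x => cpr μ {ω | Y ω = x} {ω | Y' ω = y}
  have hq0 : 0 ≤ q 0 := cpr_nonneg _ _ _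
  have hq1 : 0 ≤ q 1 := cpr_nonneg _ _ _
  have cell_nonneg : ∀ d1 d0 y1 y0, 0 ≤ pr μ (cell d1 d0 y1 y0) :=
    fun _ _ _ _ => pr_nonneg _ _
  have pos_Z : ∀ z ∈ bin01, pr μ {ω | Z ω = z} ≠ 0 := fun z hz h =>
    h_posDZ 0 m0 z hz (measure_mono_null Set.inter_subset_right ((pr_eq_zero_iff μ).1 h))
  have cell_indep : ∀ z d1 d0 y1 y0,
      pr μ ({ω | Z ω = z} ∩ cell d1 d0 y1 y0) = pr μ {ω | Z ω = z} * pr μ (cell d1 d0 y1 y0) := by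
    intro z d1 d0 y1 y0
    have h := h_indep.measure_inter_preimage_eq_mul {z} {(y1, y0, d1, d0)}
      (measurableSet_singleton _) (measurableSet_singleton _)
    have e : (fun ω => (Y1 ω, Y0 ω, D1 ω, D0 ω)) ⁻¹' {(y1, y0, d1, d0)} = cell d1 d0 y1 y0 := by
      ext ω
      simp only [cell, Set.mem_preimage, Set.mem_singleton_iff, Prod.mk.injEq, Set.mem_inter_iff,
        Set.mem_ofPred_eq]
      tauto
    rw [e] at h
    have h' := congrArg ENNReal.toReal h
    rw [ENNReal.toReal_mul] at h'
    exact h'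
  have joint : ∀ x ∈ bin01, ∀ z ∈ bin01, ∀ d1 ∈ bin01, ∀ d0 ∈ bin01, ∀ y1 ∈ bin01, ∀ y0 ∈ bin01,
      x = z * y1 + (1 - z) * y0 →
      pr μ ({ω | Z ω = z} ∩ {ω | Y' ω = y} ∩ {ω | D1 ω = d1 ∧ D0 ω = d0} ∩ {ω | Y1 ω = y1}
          ∩ {ω | Y0 ω = y0})
        = pr μ {ω | Z ω = z} * (q x * pr μ (cell d1 d0 y1 y0)) := by
    intro x hx z hz d1 hd1 d0 hd0 y1 hy1 y0 hy0 hxz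
    let C : Set Ω := {ω | Y ω = x} ∩ {ω | Z ω = z} ∩ {ω | D1 ω = d1} ∩ {ω | D0 ω = d0}
      ∩ {ω | Y1 ω = y1} ∩ {ω | Y0 ω = y0}
    have hC : MeasurableSet C :=
      (((((meas h_meas_Y x).inter (meas h_meas_Z z)).inter (meas h_meas_D1 d1)).inter
        (meas h_meas_D0 d0)).inter (meas h_meas_Y1 y1)).inter (meas h_meas_Y0 y0)
    have eC : C = {ω | Z ω = z} ∩ cell d1 d0 y1 y0 := by
      ext ω
      simp only [C, cell, Set.mem_inter_iff, Set.mem_ofPred_eq]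
      constructor
      · tauto
      · rintro ⟨hZ, ⟨⟨h1, h0⟩, hY1⟩, hY0⟩
        have hY : Y ω = x := by rw [h_consY, hZ, hY1, hY0, hxz]
        tauto
    have e : {ω | Z ω = z} ∩ {ω | Y' ω = y} ∩ {ω | D1 ω = d1 ∧ D0 ω = d0} ∩ {ω | Y1 ω = y1}
          ∩ {ω | Y0 ω = y0} = C ∩ {ω | Y' ω = y} := by
      rw [eC]
      ext ω
      simp only [cell, Set.mem_inter_iff, Set.mem_ofPred_eq]
      tauto
    have hprod : pr μ (C ∩ {ω | Y' ω = y}) = q x * pr μ C := by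
      by_cases h : μ C = 0
      · rw [(pr_eq_zero_iff μ).2 h, mul_zero, pr_eq_zero_iff]
        exact measure_mono_null Set.inter_subset_left h
      · rw [pr_inter_eq_cpr_mul μ hC]
        exact congrArg (· * pr μ C) (h_ndY x hx y hy z hz d1 hd1 d0 hd0 y1 hy1 y0 hy0 h)
    rw [e, hprod, eC, cell_indep]
    ring
  have stratum : ∀ z ∈ bin01, ∀ d1 ∈ bin01, ∀ d0 ∈ bin01, ∀ a ∈ bin01, ∀ b ∈ bin01,
      a = z * 0 + (1 - z) * 1 → b = z * 1 + (1 - z) * 0 →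
      pr μ ({ω | Z ω = z} ∩ {ω | Y' ω = y} ∩ {ω | D1 ω = d1 ∧ D0 ω = d0})
        = pr μ {ω | Z ω = z} * (q 0 * pr μ (cell d1 d0 0 0) + q a * pr μ (cell d1 d0 0 1)
          + (q b * pr μ (cell d1 d0 1 0) + q 1 * pr μ (cell d1 d0 1 1))) := by
    intro z hz d1 hd1 d0 hd0 a ha b hb haz hbz
    rw [pr_split₂ μ h_meas_Y1 h_bin_Y1 h_meas_Y0 h_bin_Y0,
      joint 0 m0 z hz d1 hd1 d0 hd0 0 m0 0 m0 (by ring),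
      joint a ha z hz d1 hd1 d0 hd0 0 m0 1 m1 haz,
      joint b hb z hz d1 hd1 d0 hd0 1 m1 0 m0 hbz,
      joint 1 m1 z hz d1 hd1 d0 hd0 1 m1 1 m1 (by ring)]
    ring
  have treated : ∀ d ∈ bin01,
      cpr μ {ω | Z ω = 1} ({ω | Y' ω = y} ∩ {ω | D ω = d})
        = (q 0 * pr μ (cell d 0 0 0) + q 0 * pr μ (cell d 0 0 1)
            + (q 1 * pr μ (cell d 0 1 0) + q 1 * pr μ (cell d 0 1 1)))
          + (q 0 * pr μ (cell d 1 0 0) + q 0 * pr μ (cell d 1 0 1)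
            + (q 1 * pr μ (cell d 1 1 0) + q 1 * pr μ (cell d 1 1 1))) := by
    intro d hd
    have e : ∀ d0, {ω | Z ω = 1} ∩ ({ω | Y' ω = y} ∩ {ω | D ω = d}) ∩ {ω | D0 ω = d0}
        = {ω | Z ω = 1} ∩ {ω | Y' ω = y} ∩ {ω | D1 ω = d ∧ D0 ω = d0} := by
      intro d0
      ext ω
      simp only [Set.mem_inter_iff, Set.mem_ofPred_eq]
      by_cases hZ : Z ω = 1
      · have hD : D ω = D1 ω := by rw [h_consD, hZ]; ring
        rw [hD]
        tauto
      · tauto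
    have hZ := pos_Z 1 m1
    rw [cpr_eq_inv_mul μ (meas h_meas_Z 1),
      pr_split μ h_meas_D0 h_bin_D0 ({ω | Z ω = 1} ∩ _), e, e,
      stratum 1 m1 d hd 0 m0 0 m0 1 m1 (by ring) (by ring),
      stratum 1 m1 d hd 1 m1 0 m0 1 m1 (by ring) (by ring)]
    field_simp
  have untreated : ∀ d ∈ bin01,
      cpr μ {ω | Z ω = 0} ({ω | Y' ω = y} ∩ {ω | D ω = d})
        = (q 0 * pr μ (cell 0 d 0 0) + q 1 * pr μ (cell 0 d 0 1)
            + (q 0 * pr μ (cell 0 d 1 0) + q 1 * pr μ (cell 0 d 1 1)))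
          + (q 0 * pr μ (cell 1 d 0 0) + q 1 * pr μ (cell 1 d 0 1)
            + (q 0 * pr μ (cell 1 d 1 0) + q 1 * pr μ (cell 1 d 1 1))) := by
    intro d hd
    have e : ∀ d1, {ω | Z ω = 0} ∩ ({ω | Y' ω = y} ∩ {ω | D ω = d}) ∩ {ω | D1 ω = d1}
        = {ω | Z ω = 0} ∩ {ω | Y' ω = y} ∩ {ω | D1 ω = d1 ∧ D0 ω = d} := by
      intro d1
      ext ω
      simp only [Set.mem_inter_iff, Set.mem_ofPred_eq]
      by_cases hZ : Z ω = 0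
      · have hD : D ω = D0 ω := by rw [h_consD, hZ]; ring
        rw [hD]
        tauto
      · tauto
    have hZ := pos_Z 0 m0
    rw [cpr_eq_inv_mul μ (meas h_meas_Z 0),
      pr_split μ h_meas_D1 h_bin_D1 ({ω | Z ω = 0} ∩ _), e, e,
      stratum 0 m0 0 m0 d hd 1 m1 0 m0 (by ring) (by ring),
      stratum 0 m0 1 m1 d hd 1 m1 0 m0 (by ring) (by ring)]
    field_simp
  have defier_zero : ∀ y1 y0, pr μ (cell 0 1 y1 y0) = 0 := by
    intro y1 y0
    rw [pr_eq_zero_iff]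
    refine measure_mono_null ?_ (ae_iff.1 h_mono)
    rintro ω ⟨⟨⟨h1, h0⟩, -⟩, -⟩
    simp [h1, h0]
  have meas_stratum : ∀ d1 d0, MeasurableSet {ω | D1 ω = d1 ∧ D0 ω = d0} := fun d1 d0 =>
    (meas h_meas_D1 d1).inter (meas h_meas_D0 d0)
  have always : pr μ (cell 1 1 1 0) = pr μ (cell 1 1 0 1) :=
    pr_off_diagonal_eq μ h_meas_Y1 h_bin_Y1 h_meas_Y0 h_bin_Y0 (meas_stratum 1 1) h_exclA
  have never : pr μ (cell 0 0 1 0) = pr μ (cell 0 0 0 1) :=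
    pr_off_diagonal_eq μ h_meas_Y1 h_bin_Y1 h_meas_Y0 h_bin_Y0 (meas_stratum 0 0) h_exclN
  have t0 := fun y1 y0 => mul_nonneg hq0 (cell_nonneg 1 0 y1 y0)
  have t1 := fun y1 y0 => mul_nonneg hq1 (cell_nonneg 1 0 y1 y0)
  constructor
  · rw [treated 1 m1, untreated 1 m1, always]
    simp only [defier_zero]
    linarith [t0 0 0, t0 0 1, t1 1 0, t1 1 1]
  · rw [treated 0 m0, untreated 0 m0, never]
    simp only [defier_zero]
    linarith [t0 0 0, t1 0 1, t0 1 0, t1 1 1]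
end

section
/- Suppose Assumptions 1(a) and 1(b) hold (Z independent of (Y_1,Y_0,D_1,D_0) and D_1 ≥ D_0 almost surely), only D is mismeasured, the measurement error of D is non-differential (D' is independent of Z given D), all conditioning events have positive probability, and r_D > 0. Then RD_{D'|Z} ≥ 0. -/
open MeasureTheory ProbabilityTheory

theorem cpr_compl {Ω : Type*} [MeasurableSpace Ω] (μ : Measure Ω) [IsFiniteMeasure μ]
    {B A : Set Ω} (hA : MeasurableSet A) (hB : μ B ≠ 0) : cpr μ B Aᶜ = 1 - cpr μ B A := by
  have := cond_isProbabilityMeasure hB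
  exact probReal_compl_eq_one_sub (μ := cond μ B) hA

/-- The law of total probability, conditionally on `B`. -/
theorem cpr_eq_add {Ω : Type*} [MeasurableSpace Ω] (μ : Measure Ω) [IsFiniteMeasure μ]
    {A B C : Set Ω} (hB : MeasurableSet B) (hC : MeasurableSet C) :
    cpr μ B A = cpr μ (C ∩ B) A * cpr μ B C + cpr μ (Cᶜ ∩ B) A * cpr μ B Cᶜ := by
  unfold cpr
  rw [Set.inter_comm C, Set.inter_comm Cᶜ, ← cond_cond_eq_cond_inter hB hC,
    ← cond_cond_eq_cond_inter hB hC.compl, ← ENNReal.toReal_mul, ← ENNReal.toReal_mul,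
    ← ENNReal.toReal_add (by finiteness) (by finiteness), cond_add_cond_compl_eq hC]

theorem cpr_congr_inter {Ω : Type*} [MeasurableSpace Ω] (μ : Measure Ω)
    {A A' B : Set Ω} (hB : MeasurableSet B) (h : B ∩ A = B ∩ A') : cpr μ B A = cpr μ B A' := by
  rw [cpr, cpr, cond_apply hB, cond_apply hB, h]

theorem cpr_eq_toReal_of_indep {Ω : Type*} [MeasurableSpace Ω] (μ : Measure Ω)
    [IsFiniteMeasure μ] {A B : Set Ω} (hB : MeasurableSet B) (hB0 : μ B ≠ 0)
    (h : μ (B ∩ A) = μ B * μ A) : cpr μ B A = (μ A).toReal := by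
  rw [cpr, cond_apply hB, h, ← mul_assoc, ENNReal.inv_mul_cancel hB0 (measure_ne_top μ B),
    one_mul]

set_option maxHeartbeats 1000000 in
theorem stmt10 {Ω : Type*} [MeasurableSpace Ω]
    (μ : MeasureTheory.Measure Ω) [IsProbabilityMeasure μ]
    (Z D Y D' D1 D0 Y1 Y0 : Ω → ℝ)
    (h_meas_Z : Measurable Z)
    (h_meas_D : Measurable D)
    (h_meas_Y : Measurable Y)
    (h_meas_Dp : Measurable D')
    (h_meas_D1 : Measurable D1)
    (h_meas_D0 : Measurable D0)
    (h_meas_Y1 : Measurable Y1)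
    (h_meas_Y0 : Measurable Y0)
    (h_bin_Z : ∀ ω, Z ω = 0 ∨ Z ω = 1)
    (h_bin_Dp : ∀ ω, D' ω = 0 ∨ D' ω = 1)
    (h_bin_D1 : ∀ ω, D1 ω = 0 ∨ D1 ω = 1)
    (h_bin_D0 : ∀ ω, D0 ω = 0 ∨ D0 ω = 1)
    (h_bin_Y1 : ∀ ω, Y1 ω = 0 ∨ Y1 ω = 1)
    (h_bin_Y0 : ∀ ω, Y0 ω = 0 ∨ Y0 ω = 1)
    (h_consD : ∀ ω, D ω = Z ω * D1 ω + (1 - Z ω) * D0 ω)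
    (h_consY : ∀ ω, Y ω = Z ω * Y1 ω + (1 - Z ω) * Y0 ω)
    (h_indep : IndepFun Z (fun ω => (Y1 ω, Y0 ω, D1 ω, D0 ω)) μ)
    (h_mono : ∀ᵐ ω ∂μ, D0 ω ≤ D1 ω)
    (h_posDZ : ∀ d ∈ bin01, ∀ z ∈ bin01,
      μ ({ω | D ω = d} ∩ {ω | Z ω = z}) ≠ 0)
    (h_ndD : ∀ d ∈ bin01, ∀ d' ∈ bin01, ∀ z ∈ bin01,
      cpr μ ({ω | D ω = d} ∩ {ω | Z ω = z}) {ω | D' ω = d'}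
        = cpr μ {ω | D ω = d} {ω | D' ω = d'})
    (SND SPD : ℝ)
    (h_SND : SND = cpr μ {ω | D ω = 1} {ω | D' ω = 1})
    (h_SPD : SPD = cpr μ {ω | D ω = 0} {ω | D' ω = 0})
    (h_rD : 0 < SND + SPD - 1) :
    0 ≤ cpr μ {ω | Z ω = 1} {ω | D' ω = 1} - cpr μ {ω | Z ω = 0} {ω | D' ω = 1} := by
  have m0 : (0 : ℝ) ∈ bin01 := by simp [bin01]
  have m1 : (1 : ℝ) ∈ bin01 := by simp [bin01]
  have hZm (z : ℝ) : MeasurableSet {ω | Z ω = z} := h_meas_Z (measurableSet_singleton z)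
  have hDm : MeasurableSet {ω | D ω = 1} := h_meas_D (measurableSet_singleton 1)
  have hDpm : MeasurableSet {ω | D' ω = 1} := h_meas_Dp (measurableSet_singleton 1)
  have hZpos {z : ℝ} (hz : z ∈ bin01) : μ {ω | Z ω = z} ≠ 0 := fun h =>
    h_posDZ 0 m0 z hz (measure_mono_null Set.inter_subset_right h)
  have hDpos : μ {ω | D ω = 0} ≠ 0 := fun h =>
    h_posDZ 0 m0 0 m0 (measure_mono_null Set.inter_subset_left h)
  have hDc : {ω | D ω = 1}ᶜ = {ω | D ω = 0} := by
    ext ω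
    have := h_consD ω
    rcases h_bin_Z ω with hz | hz <;> rcases h_bin_D1 ω with h1 | h1 <;>
      rcases h_bin_D0 ω with h0 | h0 <;> simp_all
  have hDpc : {ω | D' ω = 1}ᶜ = {ω | D' ω = 0} := by
    ext ω
    rcases h_bin_Dp ω with h | h <;> simp [h]
  have hSPD : cpr μ {ω | D ω = 0} {ω | D' ω = 1} = 1 - SPD := by
    rw [h_SPD, ← hDpc, cpr_compl μ hDpm hDpos]
    ring
  have key {z : ℝ} (hz : z ∈ bin01) : cpr μ {ω | Z ω = z} {ω | D' ω = 1}
      = (1 - SPD) + (SND + SPD - 1) * cpr μ {ω | Z ω = z} {ω | D ω = 1} := by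
    rw [cpr_eq_add μ (hZm z) hDm, cpr_compl μ hDm (hZpos hz), hDc, h_ndD 1 m1 1 m1 z hz,
      h_ndD 0 m0 1 m1 z hz, hSPD, ← h_SND]
    ring
  have hZD1 : IndepFun Z D1 μ := h_indep.comp (φ := id)
    (ψ := fun p : ℝ × ℝ × ℝ × ℝ => p.2.2.1) measurable_id (by fun_prop)
  have e1 : cpr μ {ω | Z ω = 1} {ω | D ω = 1} = (μ {ω | D1 ω = 1}).toReal := by
    rw [cpr_congr_inter μ (A' := {ω | D1 ω = 1}) (hZm 1)]
    · exact cpr_eq_toReal_of_indep μ (hZm 1) (hZpos m1)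
        (hZD1.measure_inter_preimage_eq_mul {1} {1}
          (measurableSet_singleton 1) (measurableSet_singleton 1))
    · ext ω
      simp +contextual [h_consD]
  have hZD0 : IndepFun Z D0 μ := h_indep.comp (φ := id)
    (ψ := fun p : ℝ × ℝ × ℝ × ℝ => p.2.2.2) measurable_id (by fun_prop)
  have e0 : cpr μ {ω | Z ω = 0} {ω | D ω = 1} = (μ {ω | D0 ω = 1}).toReal := by
    rw [cpr_congr_inter μ (A' := {ω | D0 ω = 1}) (hZm 0)]
    · exact cpr_eq_toReal_of_indep μ (hZm 0) (hZpos m0)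
        (hZD0.measure_inter_preimage_eq_mul {0} {1}
          (measurableSet_singleton 0) (measurableSet_singleton 1))
    · ext ω
      simp +contextual [h_consD]
  have hle : (μ {ω | D0 ω = 1}).toReal ≤ (μ {ω | D1 ω = 1}).toReal := by
    refine ENNReal.toReal_mono (measure_ne_top _ _) (measure_mono_ae ?_)
    filter_upwards [h_mono] with ω hω (h0 : D0 ω = 1)
    show D1 ω = 1
    rcases h_bin_D1 ω with h | h
    · linarith
    · exact h
  rw [key m1, key m0, e1, e0]
  nlinarith [mul_nonneg h_rD.le (sub_nonneg.2 hle)]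
end
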